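/- arXiv:2212.08795 — 2 statements merged into one kernel-verified Lean document; each statement's English description precedes it below -/
import Mathlib

section
/- For all integers n, k with 0 ≤ k ≤ n, the number of Dyck words of semilength n+1 with exactly n+1−k returns equals the Catalan triangle entry C(n,k); that is, S(n+1, n+1−k) = C(n,k). -/
/-- `w` is a Dyck word: `true` is an up-step (U), `false` is a down-step (D);
every prefix has at least as many U's as D's, and the whole word is balanced. -/
def IsDyckWord (w : List Bool) : Prop :=
  (∀ i : ℕ, (w.take i).count false ≤ (w.take i).count true) ∧
    w.count false = w.count true

/-- The number of returns of a word: the number of nonempty balanced prefixes,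
i.e. the number of (down-)steps after which the running count of U's minus D's is `0`. -/
def dyckReturns (w : List Bool) : ℕ :=
  ((Finset.Icc 1 w.length).filter
    (fun i => (w.take i).count true = (w.take i).count false)).card

/-- `dyckCount n k` (the quantity `S(n,k)`): the number of Dyck words of
semilength `n` with exactly `k` returns. -/
noncomputable def dyckCount (n k : ℕ) : ℕ :=
  Set.ncard {w : List Bool | w.length = 2 * n ∧ IsDyckWord w ∧ dyckReturns w = k}

/-- The Catalan triangle entry `C(n,k) = choose (n+k) k - choose (n+k) (k-1)`
(with the convention that the binomial coefficient at index `-1` is `0`). -/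
def catalanTriangle (n k : ℕ) : ℕ :=
  (n + k).choose k - if k = 0 then 0 else (n + k).choose (k - 1)

/-- The Borel triangle entry `B(n,k) = ∑_{s=k}^{n} choose s k * C(n,s)`. -/
def borelTriangle (n k : ℕ) : ℕ :=
  ∑ s ∈ Finset.Icc k n, s.choose k * catalanTriangle n s

/-- The words of length `m` describing paths that start at height `h`, stay nonnegative, end at
height `0`, and contain exactly `k` down-steps reaching height `0`. -/
def pathsToZero : ℕ → ℕ → ℕ → Finset (List Bool)
  | 0, 0, 0 => {[]}
  | 0, _, _ => ∅
  | m + 1, 0, k => (pathsToZero m 1 k).image (List.cons true)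
  | m + 1, 1, 0 => (pathsToZero m 2 0).image (List.cons true)
  | m + 1, 1, k + 1 =>
      (pathsToZero m 2 (k + 1)).image (List.cons true) ∪
        (pathsToZero m 0 k).image (List.cons false)
  | m + 1, h + 2, k =>
      (pathsToZero m (h + 3) k).image (List.cons true) ∪
        (pathsToZero m (h + 1) k).image (List.cons false)

/-- The number of nonempty prefixes of `w` after which a path started at height `h` is at
height `0`. -/
def zeroVisits (h : ℕ) (w : List Bool) : ℕ :=
  ∑ i ∈ Finset.range w.length,
    if h + (w.take (i + 1)).count true = (w.take (i + 1)).count false then 1 else 0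

lemma zeroVisits_cons_true (h : ℕ) (w : List Bool) :
    zeroVisits h (true :: w) = zeroVisits (h + 1) w := by
  simp only [zeroVisits, List.length_cons, Finset.sum_range_succ', List.take_succ_cons]
  simp [add_assoc, add_comm 1]

lemma zeroVisits_one_cons_false (w : List Bool) :
    zeroVisits 1 (false :: w) = zeroVisits 0 w + 1 := by
  simp only [zeroVisits, List.length_cons, Finset.sum_range_succ', List.take_succ_cons]
  simp [add_comm 1]

lemma zeroVisits_add_two_cons_false (h : ℕ) (w : List Bool) :
    zeroVisits (h + 2) (false :: w) = zeroVisits (h + 1) w := by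
  simp only [zeroVisits, List.length_cons, Finset.sum_range_succ', List.take_succ_cons]
  simp [add_right_comm _ _ (List.count true _)]

lemma dyckReturns_eq_zeroVisits (w : List Bool) : dyckReturns w = zeroVisits 0 w := by
  rw [dyckReturns, Finset.card_filter, zeroVisits, Finset.range_eq_Ico,
    ← Finset.Ico_add_one_right_eq_Icc,
    Finset.sum_Ico_add' (fun i => if 0 + (w.take i).count true = (w.take i).count false
      then 1 else 0) 0 w.length 1]
  simp

lemma mem_pathsToZero (m h k : ℕ) (w : List Bool) :
    w ∈ pathsToZero m h k ↔ w.length = m ∧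
      (∀ i : ℕ, (w.take i).count false ≤ h + (w.take i).count true) ∧
      w.count false = h + w.count true ∧ zeroVisits h w = k := by
  induction w generalizing m h k with
  | nil =>
    fun_cases pathsToZero m h k <;> simp_all [zeroVisits]
    grind
  | cons b w ih =>
    rw [← Nat.and_forall_add_one]
    fun_cases pathsToZero m h k <;> cases b <;>
      simp [ih, zeroVisits_cons_true, zeroVisits_one_cons_false,
        zeroVisits_add_two_cons_false]
    · exact fun _ hprefix => absurd (hprefix 0) (by simp)
    all_goals
      exact fun _ => and_congr (forall_congr' fun i => by omega) (and_congr_left' (by omega))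

lemma dyckCount_eq_card_pathsToZero (n k : ℕ) :
    dyckCount n k = (pathsToZero (2 * n) 0 k).card := by
  rw [dyckCount, ← Set.ncard_coe_finset]
  congr 1
  ext w
  simp [mem_pathsToZero, IsDyckWord, dyckReturns_eq_zeroVisits, and_assoc]

lemma card_image_cons (b : Bool) (s : Finset (List Bool)) :
    (s.image (List.cons b)).card = s.card :=
  Finset.card_image_of_injective _ List.cons_injective

lemma card_image_cons_union (s t : Finset (List Bool)) :
    (s.image (List.cons true) ∪ t.image (List.cons false)).card = s.card + t.card := by
  rw [Finset.card_union_of_disjoint, card_image_cons, card_image_cons]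
  simp [Finset.disjoint_left]

lemma pathsToZero_succ_zero (m h : ℕ) : pathsToZero m (h + 1) 0 = ∅ := by
  induction m generalizing h with
  | zero => simp [pathsToZero]
  | succ m ih => cases h <;> simp [pathsToZero, ih]

lemma pathsToZero_eq_empty (m : ℕ) :
    (∀ k, m < 2 * k → pathsToZero m 0 k = ∅) ∧
      ∀ h k, m < h + 1 + 2 * k → pathsToZero m (h + 1) (k + 1) = ∅ := by
  induction m with
  | zero =>
    refine ⟨fun k hk => ?_, fun h k _ => by simp [pathsToZero]⟩
    cases k <;> simp_all [pathsToZero]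
  | succ m ih =>
    refine ⟨fun k hk => ?_, fun h k hk => ?_⟩
    · cases k with
      | zero => omega
      | succ k => simp [pathsToZero, ih.2 0 k (by omega)]
    · cases h with
      | zero => simp [pathsToZero, ih.2 1 k (by omega), ih.1 k (by omega)]
      | succ h => simp [pathsToZero, ih.2 (h + 2) k (by omega), ih.2 h k (by omega)]

/-- The number of paths with `u` up-steps that start at height `s` and reach height `0` for the
first time at their last step. -/
def firstPassageCount : ℕ → ℕ → ℕ
  | 0, _ => 1
  | _ + 1, 0 => 0
  | u + 1, s + 1 => firstPassageCount u (s + 2) + firstPassageCount (u + 1) s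

lemma firstPassageCount_succ_add_choose (u s : ℕ) :
    firstPassageCount (u + 1) s + (2 * u + 1 + s).choose u = (2 * u + 1 + s).choose (u + 1) := by
  induction u generalizing s with
  | zero =>
    induction s with
    | zero => simp [firstPassageCount]
    | succ s ih => simp [firstPassageCount] at ih ⊢; omega
  | succ u ihu =>
    induction s with
    | zero =>
      simpa [firstPassageCount] using Nat.choose_symm_half (u + 1) |>.symm
    | succ s ih =>
      have h := ihu (s + 2)
      rw [firstPassageCount]
      have e : 2 * (u + 1) + 1 + (s + 1) = (2 * (u + 1) + 1 + s) + 1 := by ring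
      rw [show 2 * u + 1 + (s + 2) = 2 * (u + 1) + 1 + s by ring] at h
      rw [e, Nat.choose_succ_succ', Nat.choose_succ_succ' _ (u + 1)]
      omega

lemma firstPassageCount_eq_catalanTriangle (u s : ℕ) :
    firstPassageCount u (s + 1) = catalanTriangle (u + s) u := by
  cases u with
  | zero => simp [firstPassageCount, catalanTriangle]
  | succ u =>
    have h := firstPassageCount_succ_add_choose u (s + 1)
    rw [show 2 * u + 1 + (s + 1) = u + 1 + s + (u + 1) by ring] at h
    simp only [catalanTriangle, Nat.add_one_ne_zero, if_false, Nat.add_sub_cancel]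
    omega

lemma card_pathsToZero (m : ℕ) :
    (∀ u k, m = 2 * (u + k) → (pathsToZero m 0 k).card = firstPassageCount u k) ∧
      ∀ u h k, m = 2 * (u + k) + h + 1 →
        (pathsToZero m (h + 1) (k + 1)).card = firstPassageCount u (h + 1 + k) := by
  induction m with
  | zero =>
    refine ⟨fun u k hm => ?_, fun u h k hm => by omega⟩
    obtain ⟨rfl, rfl⟩ : u = 0 ∧ k = 0 := by omega
    simp [pathsToZero, firstPassageCount]
  | succ m ih =>
    refine ⟨fun u k hm => ?_, fun u h k hm => ?_⟩
    · rw [pathsToZero, card_image_cons]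
      cases k with
      | zero =>
        obtain ⟨u, rfl⟩ : ∃ v, u = v + 1 := ⟨u - 1, by omega⟩
        simp [pathsToZero_succ_zero, firstPassageCount]
      | succ k => rw [ih.2 u 0 k (by omega), zero_add, add_comm]
    · cases h with
      | zero =>
        rw [pathsToZero, card_image_cons_union, ih.1 u k (by omega)]
        cases u with
        | zero => simp [(pathsToZero_eq_empty m).2 1 k (by omega), firstPassageCount]
        | succ u =>
          rw [ih.2 u 1 k (by omega), show 0 + 1 + k = k + 1 by ring, firstPassageCount,
            show 1 + 1 + k = k + 2 by ring]
      | succ h =>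
        rw [pathsToZero, card_image_cons_union, ih.2 u h k (by omega)]
        cases u with
        | zero => simp [(pathsToZero_eq_empty m).2 (h + 2) k (by omega), firstPassageCount]
        | succ u =>
          rw [ih.2 u (h + 2) k (by omega), show h + 1 + 1 + k = h + 1 + k + 1 by ring,
            firstPassageCount, show h + 2 + 1 + k = h + 1 + k + 2 by ring]

/-- For 0 ≤ k ≤ n, the number of Dyck words of semilength n+1 with exactly
n+1-k returns equals the Catalan triangle entry C(n,k). -/
theorem dyckCount_eq_catalanTriangle (n k : ℕ) (hkn : k ≤ n) :
    dyckCount (n + 1) (n + 1 - k) = catalanTriangle n k := by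
  obtain ⟨s, rfl⟩ := Nat.exists_eq_add_of_le hkn
  rw [dyckCount_eq_card_pathsToZero, (card_pathsToZero _).1 k _ (by omega),
    show k + s + 1 - k = s + 1 by omega, firstPassageCount_eq_catalanTriangle]
end

section
/- Let δ ≥ 1 and let G be a δ-regular tree. For every vertex v and every n ≥ 1, the number W_{2n} of closed walks of length 2n at v satisfies, as integers, W_{2n} = ∑_{ℓ=0}^{n−1} (−1)^ℓ·B(n−1,ℓ)·δ^{n−ℓ}, where B(n,k) is the Borel triangle entry. -/
/-- The entries `C(a - 1, s)` of the Catalan triangle as integers, extended to `a = 0` and to all `s`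
by the same binomial formula. -/
def shiftedCatalanTriangle (a : ℕ) : ℕ → ℤ
  | 0 => 1
  | s + 1 => (a + s).choose (s + 1) - (a + s).choose s

theorem shiftedCatalanTriangle_zero_right (a : ℕ) : shiftedCatalanTriangle a 0 = 1 := rfl

theorem shiftedCatalanTriangle_succ_succ (a s : ℕ) :
    shiftedCatalanTriangle (a + 1) (s + 1) =
      shiftedCatalanTriangle a (s + 1) + shiftedCatalanTriangle (a + 1) s := by
  cases s with
  | zero => simp [shiftedCatalanTriangle]
  | succ s =>
    have h : a + 1 + (s + 1) = a + s + 1 + 1 := by ring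
    have h' : a + (s + 1) = a + s + 1 := by ring
    have h'' : a + 1 + s = a + s + 1 := by ring
    simp only [shiftedCatalanTriangle, h, h', h'', Nat.choose_succ_succ' (a + s + 1)]
    push_cast
    ring

theorem shiftedCatalanTriangle_self_succ (k : ℕ) :
    shiftedCatalanTriangle (k + 1) (k + 1) = 0 := by
  rw [shiftedCatalanTriangle, Nat.choose_symm_of_eq_add rfl, sub_self]

theorem catalanTriangle_eq_shifted {n s : ℕ} (h : s ≤ n) :
    (catalanTriangle n s : ℤ) = shiftedCatalanTriangle (n + 1) s := by
  cases s with
  | zero => simp [catalanTriangle, shiftedCatalanTriangle]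
  | succ s =>
    have hle : (n + s + 1).choose s ≤ (n + s + 1).choose (s + 1) :=
      Nat.choose_le_succ_of_lt_half_left (by omega)
    have h' : n + (s + 1) = n + s + 1 := by ring
    have h'' : n + 1 + s = n + s + 1 := by ring
    simp only [catalanTriangle, shiftedCatalanTriangle, h', h'', Nat.succ_ne_zero, if_false,
      Nat.add_sub_cancel]
    exact Nat.cast_sub hle

/-- The number of walks of length `d + 2 * k` between two vertices at distance `d` in a
`δ`-regular tree; see `card_finsetWalkLength_eq_treeWalkCount`. -/
def treeWalkCount (δ : ℤ) (d k : ℕ) : ℤ :=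
  ∑ s ∈ Finset.range (k + 1), shiftedCatalanTriangle (d + k) s * δ ^ (k - s) * (δ - 1) ^ s

theorem treeWalkCount_zero_right (δ : ℤ) (d : ℕ) : treeWalkCount δ d 0 = 1 := by
  simp [treeWalkCount, shiftedCatalanTriangle_zero_right]

theorem treeWalkCount_succ_succ (δ : ℤ) (d k : ℕ) :
    treeWalkCount δ (d + 1) (k + 1) =
      treeWalkCount δ d (k + 1) + (δ - 1) * treeWalkCount δ (d + 2) k := by
  have h : d + 1 + (k + 1) = d + k + 1 + 1 := by ring
  have h' : d + (k + 1) = d + k + 1 := by ring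
  have h'' : d + 2 + k = d + k + 1 + 1 := by ring
  simp only [treeWalkCount, Finset.sum_range_succ' _ (k + 1), h, h', h'',
    shiftedCatalanTriangle_succ_succ, shiftedCatalanTriangle_zero_right, Finset.mul_sum, add_mul,
    Finset.sum_add_distrib, Nat.add_sub_add_right]
  rw [add_right_comm]
  congr 1
  exact Finset.sum_congr rfl fun s _ => by ring

theorem treeWalkCount_zero_succ (δ : ℤ) (k : ℕ) :
    treeWalkCount δ 0 (k + 1) = δ * treeWalkCount δ 1 k := by
  rw [treeWalkCount, Finset.sum_range_succ, zero_add, shiftedCatalanTriangle_self_succ,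
    treeWalkCount, Finset.mul_sum, zero_mul, zero_mul, add_zero, add_comm 1 k]
  refine Finset.sum_congr rfl fun s hs => ?_
  rw [Nat.succ_sub (Finset.mem_range_succ_iff.mp hs), pow_succ]
  ring

theorem sum_borelTriangle_eq_treeWalkCount (δ : ℤ) (m : ℕ) :
    ∑ ℓ ∈ Finset.range (m + 1), (-1) ^ ℓ * (borelTriangle m ℓ : ℤ) * δ ^ (m + 1 - ℓ) =
      treeWalkCount δ 0 (m + 1) := by
  rw [treeWalkCount_zero_succ, treeWalkCount]
  have key : ∀ ℓ ∈ Finset.range (m + 1),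
      (-1) ^ ℓ * (borelTriangle m ℓ : ℤ) * δ ^ (m + 1 - ℓ) =
        ∑ s ∈ Finset.range (m + 1),
          (-1) ^ ℓ * (s.choose ℓ * catalanTriangle m s : ℤ) * δ ^ (m + 1 - ℓ) := by
    intro ℓ _
    rw [borelTriangle, Nat.cast_sum, Finset.mul_sum, Finset.sum_mul]
    push_cast
    refine Finset.sum_subset (fun s hs => ?_) fun s hs hs' => ?_
    · simp only [Finset.mem_Icc, Finset.mem_range] at *
      omega
    · simp only [Finset.mem_Icc, Finset.mem_range] at *
      rw [Nat.choose_eq_zero_of_lt (by omega)]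
      simp
  rw [Finset.sum_congr rfl key, Finset.sum_comm, Finset.mul_sum]
  refine Finset.sum_congr rfl fun s hs => ?_
  have hs : s ≤ m := Finset.mem_range_succ_iff.mp hs
  rw [catalanTriangle_eq_shifted hs, sub_eq_neg_add, add_pow, Finset.mul_sum, Finset.mul_sum,
    add_comm 1 m]
  symm
  refine Finset.sum_subset_zero_on_sdiff (Finset.range_mono (by omega)) (fun ℓ hℓ => ?_)
    fun ℓ hℓ => ?_
  · simp only [Finset.mem_sdiff, Finset.mem_range] at hℓ
    rw [Nat.choose_eq_zero_of_lt (by omega)]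
    simp
  · have hℓ : ℓ ≤ s := Finset.mem_range_succ_iff.mp hℓ
    have hexp : m + 1 - ℓ = 1 + (m - s) + (s - ℓ) := by omega
    rw [hexp, pow_add, pow_add]
    ring

namespace SimpleGraph

variable {V : Type*} {G : SimpleGraph V}

theorem card_finsetWalkLength_succ [DecidableEq V] [G.LocallyFinite] (m : ℕ) (u v : V) :
    (G.finsetWalkLength (m + 1) u v).card =
      ∑ w ∈ G.neighborFinset u, (G.finsetWalkLength m w v).card := by
  rw [finsetWalkLength, Finset.card_biUnion]
  · simp only [Finset.card_map]
    exact (Finset.sum_subtype (G.neighborFinset u) (by simp)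
      fun w => (G.finsetWalkLength m w v).card).symm
  · intro w _ w' _ hne
    simp only [Finset.disjoint_left, Finset.mem_map]
    rintro _ ⟨p, _, rfl⟩ ⟨q, _, h⟩
    exact hne (Subtype.ext (Walk.cons.inj h).1.symm)

theorem finsetWalkLength_eq_empty_of_lt_dist [DecidableEq V] [G.LocallyFinite] {m : ℕ} {u v : V}
    (h : m < G.dist u v) : G.finsetWalkLength m u v = ∅ := by
  refine Finset.eq_empty_of_forall_notMem fun p hp => ?_
  rw [mem_finsetWalkLength_iff] at hp
  have := dist_le p
  omega

theorem IsTree.existsUnique_adj_dist_add_one_eq (hG : G.IsTree) {u v : V} (h : u ≠ v) :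
    ∃! w, G.Adj u w ∧ G.dist w v + 1 = G.dist u v := by
  obtain ⟨p, hp, hlen⟩ := hG.connected.exists_path_of_dist u v
  cases p with
  | nil => exact absurd rfl h
  | @cons _ w _ hadj p =>
    have hw : G.dist w v + 1 = G.dist u v := by
      have h₁ := dist_le p
      have h₂ := hG.dist_eq_dist_add_one_of_adj v hadj
      rw [dist_comm (u := v) (v := u), dist_comm (u := v) (v := w)] at h₂
      rw [Walk.length_cons] at hlen
      omega
    refine ⟨w, ⟨hadj, hw⟩, fun w' ⟨hadj', hw'⟩ => ?_⟩
    obtain ⟨q, hq⟩ := hG.connected.exists_walk_length_eq_dist w' v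
    have hq' : (Walk.cons hadj' q).IsPath :=
      Walk.isPath_of_length_eq_dist _ (by rw [Walk.length_cons, hq, hw'])
    have heq := (hG.existsUnique_path u v).unique hq' hp
    rw [Walk.cons.injEq] at heq
    exact heq.1

theorem IsTree.sum_neighborFinset_of_dist [G.LocallyFinite] (hG : G.IsTree) {δ : ℕ}
    (hreg : G.IsRegularOfDegree δ) {u v : V} (huv : u ≠ v) {f : V → ℤ} {a b : ℤ}
    (ha : ∀ w, G.dist w v + 1 = G.dist u v → f w = a)
    (hb : ∀ w, G.dist w v = G.dist u v + 1 → f w = b) :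
    ∑ w ∈ G.neighborFinset u, f w = a + (δ - 1) * b := by
  classical
  obtain ⟨w₀, ⟨hadj, hw₀⟩, huniq⟩ := hG.existsUnique_adj_dist_add_one_eq huv
  have hmem : w₀ ∈ G.neighborFinset u := (G.mem_neighborFinset u w₀).mpr hadj
  have hcard : (((G.neighborFinset u).erase w₀).card : ℤ) = δ - 1 := by
    rw [Finset.cast_card_erase_of_mem hmem, card_neighborFinset_eq_degree, hreg.degree_eq]
  rw [← Finset.add_sum_erase _ _ hmem, ha w₀ hw₀, Finset.sum_eq_card_nsmul (b := b), nsmul_eq_mul,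
    hcard]
  intro w hw
  rw [Finset.mem_erase, mem_neighborFinset] at hw
  refine hb w ?_
  have hd := hG.dist_eq_dist_add_one_of_adj v hw.2
  rw [dist_comm (u := v) (v := u), dist_comm (u := v) (v := w)] at hd
  exact hd.resolve_left fun h => hw.1 (huniq w ⟨hw.2, h.symm⟩)

theorem IsTree.card_finsetWalkLength_eq_treeWalkCount [DecidableEq V] [G.LocallyFinite]
    (hG : G.IsTree) {δ : ℕ} (hreg : G.IsRegularOfDegree δ) {m k : ℕ} {u v : V}
    (hm : m = G.dist u v + 2 * k) :
    ((G.finsetWalkLength m u v).card : ℤ) = treeWalkCount δ (G.dist u v) k := by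
  induction m generalizing u k with
  | zero =>
    obtain rfl : u = v := hG.connected.dist_eq_zero_iff.mp (by omega)
    obtain rfl : k = 0 := by omega
    simp [finsetWalkLength, treeWalkCount_zero_right]
  | succ m ih =>
    rw [card_finsetWalkLength_succ, Nat.cast_sum]
    by_cases huv : u = v
    · subst huv
      rw [dist_self] at hm ⊢
      obtain ⟨k, rfl⟩ : ∃ j, k = j + 1 := ⟨k - 1, by omega⟩
      rw [treeWalkCount_zero_succ, Finset.sum_eq_card_nsmul (b := treeWalkCount δ 1 k),
        nsmul_eq_mul, card_neighborFinset_eq_degree, hreg.degree_eq]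
      intro w hw
      have hd : G.dist w u = 1 := dist_eq_one_iff_adj.mpr ((G.mem_neighborFinset u w).mp hw).symm
      rw [ih (k := k) (by omega), hd]
    · have hpos := hG.connected.pos_dist_of_ne huv
      obtain ⟨d, hd⟩ : ∃ d, G.dist u v = d + 1 := ⟨G.dist u v - 1, by omega⟩
      have ha : ∀ w, G.dist w v + 1 = G.dist u v →
          ((G.finsetWalkLength m w v).card : ℤ) = treeWalkCount δ d k := by
        intro w hw
        obtain rfl : G.dist w v = d := by omega
        exact ih (by omega)
      cases k with
      | zero =>
        rw [hG.sum_neighborFinset_of_dist hreg huv ha (b := 0)]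
        · simp [treeWalkCount_zero_right]
        · intro w hw
          rw [finsetWalkLength_eq_empty_of_lt_dist (by omega), Finset.card_empty, Nat.cast_zero]
      | succ k =>
        rw [hG.sum_neighborFinset_of_dist hreg huv ha (b := treeWalkCount δ (d + 2) k), hd,
          treeWalkCount_succ_succ]
        intro w hw
        rw [ih (k := k) (by omega), hw, hd]

end SimpleGraph

/-- In a δ-regular tree, the number of closed walks of length 2n at a vertex v
equals, as an integer, the stated alternating sum of Borel triangle entries. -/
theorem closed_walks_eq_borelTriangle_sum {V : Type*} (G : SimpleGraph V)
    [G.LocallyFinite] (δ : ℕ) (hδ : 1 ≤ δ)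
    (hreg : G.IsRegularOfDegree δ) (htree : G.IsTree) (v : V)
    (n : ℕ) (hn : 1 ≤ n) :
    (Set.ncard {p : G.Walk v v | p.length = 2 * n} : ℤ)
      = ∑ ℓ ∈ Finset.range n,
          (-1) ^ ℓ * (borelTriangle (n - 1) ℓ : ℤ) * (δ : ℤ) ^ (n - ℓ) := by
  classical
  obtain ⟨m, rfl⟩ : ∃ m, n = m + 1 := ⟨n - 1, by omega⟩
  rw [← G.coe_finsetWalkLength_eq, Set.ncard_coe_finset,
    htree.card_finsetWalkLength_eq_treeWalkCount hreg (k := m + 1) (by simp), G.dist_self,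
    Nat.add_sub_cancel, sum_borelTriangle_eq_treeWalkCount]
end
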